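/- arXiv:1803.08484 — 2 statements merged into one kernel-verified Lean document; each statement's English description precedes it below -/
import Mathlib

section
/- Let A₁ and A₂ be independent random points, each uniformly distributed on the closed unit ball B_d = {x ∈ ℝ^d : ‖x‖ ≤ 1} of ℝ^d (d ≥ 1). Then for every t ∈ [0, 1]: P(‖A₁ − A₂‖/2 ≤ t) = ∫₀^t 2^d · d · ω^{d−1} · I_{1−ω²}((d+1)/2, 1/2) dω, where I_x(a, b) = (1/B(a, b)) ∫₀^x u^{a−1} (1−u)^{b−1} du is the regularized incomplete beta function. That is, the half-distance Ω = ‖A₁−A₂‖/2 has probability density 2^d d ω^{d−1} I_{1−ω²}((d+1)/2, 1/2) on (0, 1). -/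
open MeasureTheory ProbabilityTheory Metric Real

noncomputable section

/-- Uniform probability measure on the closed unit ball of `ℝ^d`. -/
def unifBall (d : ℕ) : Measure (EuclideanSpace ℝ (Fin d)) :=
  (volume (Metric.closedBall (0 : EuclideanSpace ℝ (Fin d)) 1))⁻¹ •
    volume.restrict (Metric.closedBall (0 : EuclideanSpace ℝ (Fin d)) 1)

-- Circumcenter of `n+1` points in `ℝ^d` (junk value `0` if not affinely independent).
open Classical in
def circCenter {d n : ℕ} (p : Fin (n + 1) → EuclideanSpace ℝ (Fin d)) :
    EuclideanSpace ℝ (Fin d) :=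
  if h : AffineIndependent ℝ p then
    (⟨p, h⟩ : Affine.Simplex ℝ (EuclideanSpace ℝ (Fin d)) n).circumcenter else 0

-- Circumradius of `n+1` points in `ℝ^d` (junk value `0` if not affinely independent).
open Classical in
def circRadius {d n : ℕ} (p : Fin (n + 1) → EuclideanSpace ℝ (Fin d)) : ℝ :=
  if h : AffineIndependent ℝ p then
    (⟨p, h⟩ : Affine.Simplex ℝ (EuclideanSpace ℝ (Fin d)) n).circumradius else 0

/-- The circumsphere `{x ∈ L : dist (x, C) = Ω}` as a subset of `ℝ^d`. -/
def circSphereSet {d n : ℕ} (p : Fin (n + 1) → EuclideanSpace ℝ (Fin d)) :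
    Set (EuclideanSpace ℝ (Fin d)) :=
  {x | x ∈ affineSpan ℝ (Set.range p) ∧ dist x (circCenter p) = circRadius p}

/-- `H = dist (O, O')`: the distance from the origin to the affine span. -/
def flatDist {d n : ℕ} (p : Fin (n + 1) → EuclideanSpace ℝ (Fin d)) : ℝ :=
  Metric.infDist 0 (affineSpan ℝ (Set.range p) : Set (EuclideanSpace ℝ (Fin d)))

/-- `Δ = dist (O', C)`; by Pythagoras (`C` lies in the flat), `Δ² = ‖C‖² − H²`. -/
def deltaDist {d n : ℕ} (p : Fin (n + 1) → EuclideanSpace ℝ (Fin d)) : ℝ :=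
  Real.sqrt (‖circCenter p‖ ^ 2 - flatDist p ^ 2)

/-- Euler beta function. -/
def realBeta (a b : ℝ) : ℝ := Real.Gamma a * Real.Gamma b / Real.Gamma (a + b)

/-- Gauss hypergeometric function `₂F₁`. -/
def hyp2F1 (a b c x : ℝ) : ℝ :=
  ∑' k : ℕ, (ascPochhammer ℝ k).eval a * (ascPochhammer ℝ k).eval b /
    ((ascPochhammer ℝ k).eval c * (Nat.factorial k)) * x ^ k

/-- The beta distribution `Beta(a,b)` on `(0,1)`. -/
def betaMeasure (a b : ℝ) : Measure ℝ :=
  (volume.restrict (Set.Ioo (0:ℝ) 1)).withDensity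
    (fun x => ENNReal.ofReal (x ^ (a - 1) * (1 - x) ^ (b - 1) / realBeta a b))

/-- The regularized incomplete beta function `I_x(a,b)`. -/
def regIncBeta (x a b : ℝ) : ℝ :=
  (∫ u in (0:ℝ)..x, u ^ (a - 1) * (1 - u) ^ (b - 1)) / realBeta a b

/-- The volume of the unit ball of `ℝ^n`. -/
def unitBallVolume (n : ℕ) : ℝ := √π ^ n / Gamma (n / 2 + 1)

lemma unitBallVolume_pos (n : ℕ) : 0 < unitBallVolume n := by
  unfold unitBallVolume
  have : 0 < Gamma ((n : ℝ) / 2 + 1) := Gamma_pos_of_pos (by positivity)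
  positivity

lemma volume_closedBall_eq_unitBallVolume (n : ℕ) {r : ℝ} (hr : 0 ≤ r) :
    volume (closedBall (0 : EuclideanSpace ℝ (Fin n)) r) =
      ENNReal.ofReal (r ^ n * unitBallVolume n) := by
  rcases Nat.eq_zero_or_pos n with rfl | hn
  · rw [show closedBall (0 : EuclideanSpace ℝ (Fin 0)) r = Set.univ from
      Set.eq_univ_of_forall fun x ↦ by simpa [Subsingleton.elim x 0] using hr,
      volume_euclideanSpace_eq_dirac]
    simp [unitBallVolume]
  · have : Nonempty (Fin n) := ⟨⟨0, hn⟩⟩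
    rw [EuclideanSpace.volume_closedBall, Fintype.card_fin, ENNReal.ofReal_mul (by positivity),
      ENNReal.ofReal_pow hr, unitBallVolume]

lemma volume_setOf_sum_sq_le (n : ℕ) {m : ℝ} (hm : 0 ≤ m) :
    volume {y : Fin n → ℝ | ∑ i, y i ^ 2 ≤ m} = ENNReal.ofReal (√m ^ n * unitBallVolume n) := by
  rw [← volume_closedBall_eq_unitBallVolume n (sqrt_nonneg m),
    ← (PiLp.volume_preserving_ofLp (Fin n)).measure_preimage
      (measurableSet_le (by fun_prop) measurable_const).nullMeasurableSet]
  congr 1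
  ext x
  simp [EuclideanSpace.norm_eq, sqrt_le_sqrt_iff hm]

/-- The intersection of two unit balls whose centers differ along the first axis, sliced by the
hyperplanes orthogonal to this axis. -/
lemma volume_inter_closedBall_single (n : ℕ) {w : ℝ} :
    volume (closedBall (0 : EuclideanSpace ℝ (Fin (n + 1))) 1 ∩
        closedBall (EuclideanSpace.single 0 (2 * w)) 1) =
      ∫⁻ s : ℝ, volume {y : Fin n → ℝ | ∑ i, y i ^ 2 ≤ min (1 - s ^ 2) (1 - (s - 2 * w) ^ 2)} := by
  set T : Set (ℝ × (Fin n → ℝ)) :=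
    {p | ∑ i, p.2 i ^ 2 ≤ min (1 - p.1 ^ 2) (1 - (p.1 - 2 * w) ^ 2)} with hT
  have hTm : MeasurableSet T := measurableSet_le (by fun_prop) (by fun_prop)
  rw [show (∫⁻ s : ℝ, volume {y : Fin n → ℝ | ∑ i, y i ^ 2 ≤
    min (1 - s ^ 2) (1 - (s - 2 * w) ^ 2)}) = volume T from (Measure.prod_apply hTm).symm]
  have hmp := (volume_preserving_piFinSuccAbove (fun _ : Fin (n + 1) ↦ ℝ) 0).comp
    (PiLp.volume_preserving_ofLp (Fin (n + 1)))
  rw [← hmp.measure_preimage hTm.nullMeasurableSet]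
  congr 1
  ext x
  simp only [Set.mem_inter_iff, mem_closedBall, dist_eq_norm, EuclideanSpace.norm_eq, hT]
  simp [Fin.sum_univ_succ, Fin.tail, le_sub_iff_add_le, add_comm]

lemma integral_sqrt_one_sub_min_sq (n : ℕ) {w : ℝ} (hw0 : 0 ≤ w) (hw1 : w ≤ 1) :
    ∫ s in (2 * w - 1)..1, √(min (1 - s ^ 2) (1 - (s - 2 * w) ^ 2)) ^ n =
      2 * ∫ s in w..1, √(1 - s ^ 2) ^ n := by
  have hc : Continuous fun s : ℝ ↦ √(min (1 - s ^ 2) (1 - (s - 2 * w) ^ 2)) ^ n := by fun_prop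
  rw [← intervalIntegral.integral_add_adjacent_intervals (hc.intervalIntegrable (2 * w - 1) w)
    (hc.intervalIntegrable w 1), two_mul (∫ s in w..1, √(1 - s ^ 2) ^ n)]
  congr 1
  · have h := intervalIntegral.integral_comp_sub_left (a := 2 * w - 1) (b := w)
      (fun s : ℝ ↦ √(1 - s ^ 2) ^ n) (2 * w)
    rw [show 2 * w - w = w by ring, show 2 * w - (2 * w - 1) = 1 by ring] at h
    rw [← h]
    refine intervalIntegral.integral_congr fun s hs ↦ ?_
    rw [Set.uIcc_of_le (by linarith)] at hs
    have : 1 - (s - 2 * w) ^ 2 ≤ 1 - s ^ 2 := by nlinarith [hs.2]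
    simp only [min_eq_right this]
    ring_nf
  · refine intervalIntegral.integral_congr fun s hs ↦ ?_
    rw [Set.uIcc_of_le hw1] at hs
    have : 1 - s ^ 2 ≤ 1 - (s - 2 * w) ^ 2 := by nlinarith [hs.1]
    simp only [min_eq_left this]

lemma volume_inter_closedBall_single_eq (n : ℕ) {w : ℝ} (hw0 : 0 ≤ w) (hw1 : w ≤ 1) :
    volume (closedBall (0 : EuclideanSpace ℝ (Fin (n + 1))) 1 ∩
        closedBall (EuclideanSpace.single 0 (2 * w)) 1) =
      ENNReal.ofReal (unitBallVolume n * (2 * ∫ s in w..1, √(1 - s ^ 2) ^ n)) := by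
  have hc : Continuous fun s : ℝ ↦
    √(min (1 - s ^ 2) (1 - (s - 2 * w) ^ 2)) ^ n * unitBallVolume n := by fun_prop
  have hslice : (fun s : ℝ ↦ volume {y : Fin n → ℝ | ∑ i, y i ^ 2 ≤
      min (1 - s ^ 2) (1 - (s - 2 * w) ^ 2)}) = (Set.Icc (2 * w - 1) 1).indicator fun s ↦
        ENNReal.ofReal (√(min (1 - s ^ 2) (1 - (s - 2 * w) ^ 2)) ^ n * unitBallVolume n) := by
    ext s
    by_cases hs : s ∈ Set.Icc (2 * w - 1) 1
    · rw [Set.indicator_of_mem hs, volume_setOf_sum_sq_le]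
      obtain ⟨hs1, hs2⟩ := hs
      exact le_min (by nlinarith) (by nlinarith)
    · rw [Set.indicator_of_notMem hs]
      convert! measure_empty (μ := (volume : Measure (Fin n → ℝ)))
      refine Set.eq_empty_of_forall_notMem fun y hy ↦ hs ?_
      have hy0 := (Finset.sum_nonneg fun i _ ↦ sq_nonneg (y i)).trans hy
      obtain ⟨h1, h2⟩ := le_min_iff.mp hy0
      exact ⟨by nlinarith, by nlinarith⟩
  rw [volume_inter_closedBall_single, hslice, lintegral_indicator measurableSet_Icc,
    ← ofReal_integral_eq_lintegral_ofReal hc.continuousOn.integrableOn_Icc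
      (ae_of_all _ fun s ↦ mul_nonneg (by positivity) (unitBallVolume_pos n).le),
    integral_Icc_eq_integral_Ioc, ← intervalIntegral.integral_of_le (by linarith),
    intervalIntegral.integral_mul_const, integral_sqrt_one_sub_min_sq n hw0 hw1, mul_comm]

lemma exists_linearIsometryEquiv_single_norm (n : ℕ) (z : EuclideanSpace ℝ (Fin (n + 1))) :
    ∃ e : EuclideanSpace ℝ (Fin (n + 1)) ≃ₗᵢ[ℝ] EuclideanSpace ℝ (Fin (n + 1)),
      e z = EuclideanSpace.single 0 ‖z‖ := by
  rcases eq_or_ne z 0 with rfl | hz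
  · exact ⟨.refl ℝ _, by ext i; simp [PiLp.single_apply]⟩
  have hz' : ‖z‖ ≠ 0 := norm_ne_zero_iff.mpr hz
  obtain ⟨b, hb⟩ := Orthonormal.exists_orthonormalBasis_extension_of_card_eq (𝕜 := ℝ)
    (E := EuclideanSpace ℝ (Fin (n + 1))) (ι := Fin (n + 1)) (by simp)
    (v := fun _ ↦ ‖z‖⁻¹ • z) (s := {0})
    (⟨fun _ ↦ by simp [norm_smul, hz'], fun i j hij ↦ (hij (Subsingleton.elim i j)).elim⟩)
  refine ⟨b.repr, ?_⟩
  have hz0 : z = ‖z‖ • b 0 := by rw [hb 0 rfl, smul_inv_smul₀ hz']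
  conv_lhs => rw [hz0]
  rw [map_smul, b.repr_self]
  ext i
  simp [PiLp.single_apply]

/-- The volume of the intersection of two unit balls. -/
lemma volume_inter_closedBall (n : ℕ) (z : EuclideanSpace ℝ (Fin (n + 1))) (hz : ‖z‖ ≤ 2) :
    volume (closedBall (0 : EuclideanSpace ℝ (Fin (n + 1))) 1 ∩ closedBall z 1) =
      ENNReal.ofReal (unitBallVolume n * (2 * ∫ s in (‖z‖ / 2)..1, √(1 - s ^ 2) ^ n)) := by
  obtain ⟨e, he⟩ := exists_linearIsometryEquiv_single_norm n z
  rw [← volume_inter_closedBall_single_eq n (by positivity) (by linarith),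
    mul_div_cancel₀ _ two_ne_zero, ← he, ← e.measurePreserving.measure_preimage
      (s := closedBall 0 1 ∩ closedBall (e z) 1) (measurableSet_closedBall.inter measurableSet_closedBall).nullMeasurableSet]
  congr 1
  ext x
  simp only [Set.mem_inter_iff, Set.mem_preimage, mem_closedBall, e.dist_map, dist_zero_right,
    e.norm_map]

/-- The substitution `u = 1 - s ^ 2` in the incomplete beta integral. -/
lemma integral_rpow_mul_one_sub_rpow (n : ℕ) {w : ℝ} (hw0 : 0 < w) (hw1 : w ≤ 1) :
    ∫ u in (0 : ℝ)..(1 - w ^ 2), u ^ (((n : ℝ) + 2) / 2 - 1) * (1 - u) ^ ((1 / 2 : ℝ) - 1) =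
      2 * ∫ s in w..1, √(1 - s ^ 2) ^ n := by
  have h := intervalIntegral.integral_comp_mul_deriv'' (a := 1) (b := w) (f := fun s ↦ 1 - s ^ 2)
    (f' := fun s ↦ -(2 * s))
    (g := fun u ↦ u ^ (((n : ℝ) + 2) / 2 - 1) * (1 - u) ^ ((1 / 2 : ℝ) - 1))
    (by fun_prop)
    (fun s _ ↦ by simpa using (((hasDerivAt_id s).pow 2).const_sub 1).hasDerivWithinAt)
    (by fun_prop)
    (by
      rintro _ ⟨s, hs, rfl⟩
      rw [Set.uIcc_of_ge hw1] at hs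
      refine ContinuousAt.continuousWithinAt (.mul ?_ ?_)
      · exact continuousAt_id.rpow_const (.inr (by have : (0 : ℝ) ≤ n := n.cast_nonneg; linarith))
      · refine (by fun_prop : ContinuousAt (fun u : ℝ ↦ 1 - u) _).rpow_const (.inl ?_)
        have := hw0.trans_le hs.1
        simp [this.ne'])
  rw [show (1 : ℝ) - 1 ^ 2 = 0 by norm_num] at h
  rw [← h, intervalIntegral.integral_symm, ← intervalIntegral.integral_neg,
    ← intervalIntegral.integral_const_mul]
  refine intervalIntegral.integral_congr fun s hs ↦ ?_
  rw [Set.uIcc_of_le hw1] at hs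
  have hs0 := hw0.trans_le hs.1
  have h1 : (s ^ 2) ^ ((1 / 2 : ℝ) - 1) = s⁻¹ := by
    rw [← rpow_natCast, ← rpow_mul hs0.le, ← rpow_neg_one]
    norm_num
  have h2 : (1 - s ^ 2) ^ (((n : ℝ) + 2) / 2 - 1) = √(1 - s ^ 2) ^ n := by
    rw [sqrt_eq_rpow, ← rpow_natCast (_ ^ _) n, ← rpow_mul (by nlinarith [hs.2])]
    ring_nf
  simp only [Function.comp_apply, sub_sub_cancel, h1, h2]
  field_simp

lemma unitBallVolume_succ (n : ℕ) :
    unitBallVolume (n + 1) = unitBallVolume n * realBeta (((n : ℝ) + 2) / 2) (1 / 2) := by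
  have h1 : Gamma (((n : ℝ) + 2) / 2) ≠ 0 := (Gamma_pos_of_pos (by positivity)).ne'
  rw [realBeta, unitBallVolume, unitBallVolume, Gamma_one_half_eq,
    show (n : ℝ) / 2 + 1 = (n + 2) / 2 by ring,
    show ((n : ℝ) + 2) / 2 + 1 / 2 = ((n + 1 : ℕ) : ℝ) / 2 + 1 by push_cast; ring, pow_succ]
  field_simp

lemma unitBallVolume_mul_regIncBeta (n : ℕ) {w : ℝ} (hw0 : 0 < w) (hw1 : w ≤ 1) :
    unitBallVolume (n + 1) * regIncBeta (1 - w ^ 2) (((n : ℝ) + 2) / 2) (1 / 2) =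
      unitBallVolume n * (2 * ∫ s in w..1, √(1 - s ^ 2) ^ n) := by
  have hB : realBeta (((n : ℝ) + 2) / 2) (1 / 2) ≠ 0 := by
    have h1 : 0 < Gamma (((n : ℝ) + 2) / 2) := Gamma_pos_of_pos (by positivity)
    have h2 : 0 < Gamma (1 / 2) := Gamma_pos_of_pos (by positivity)
    have h3 : 0 < Gamma (((n : ℝ) + 2) / 2 + 1 / 2) := Gamma_pos_of_pos (by positivity)
    unfold realBeta
    positivity
  rw [regIncBeta, integral_rpow_mul_one_sub_rpow n hw0 hw1, unitBallVolume_succ]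
  field_simp

/-- The law of the difference of two independent uniform points of the unit ball, evaluated on
centered balls. -/
lemma unifBall_prod_setOf_norm_sub_le (d : ℕ) (r : ℝ) :
    (unifBall d).prod (unifBall d) {p | ‖p.1 - p.2‖ ≤ r} =
      (volume (closedBall (0 : EuclideanSpace ℝ (Fin d)) 1))⁻¹ *
        ((volume (closedBall (0 : EuclideanSpace ℝ (Fin d)) 1))⁻¹ *
          ∫⁻ z in closedBall (0 : EuclideanSpace ℝ (Fin d)) r,
            volume (closedBall (0 : EuclideanSpace ℝ (Fin d)) 1 ∩ closedBall z 1)) := by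
  classical
  set B := closedBall (0 : EuclideanSpace ℝ (Fin d)) 1 with hB
  have hBm : MeasurableSet B := measurableSet_closedBall
  have hSm : MeasurableSet {p : EuclideanSpace ℝ (Fin d) × EuclideanSpace ℝ (Fin d) |
    ‖p.1 - p.2‖ ≤ r} := measurableSet_le (by fun_prop) measurable_const
  let F : EuclideanSpace ℝ (Fin d) → EuclideanSpace ℝ (Fin d) → ENNReal := fun x y ↦
    ({p : EuclideanSpace ℝ (Fin d) × EuclideanSpace ℝ (Fin d) | p.1 ∈ B ∧ p.2 ∈ B ∧
      ‖p.1 - p.2‖ ≤ r}).indicator 1 (x, y)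
  have hFm : Measurable fun p : EuclideanSpace ℝ (Fin d) × EuclideanSpace ℝ (Fin d) ↦
      F p.1 p.2 :=
    measurable_one.indicator ((hBm.preimage measurable_fst).inter
      ((hBm.preimage measurable_snd).inter hSm))
  have key : (volume.restrict B).prod (volume.restrict B) {p | ‖p.1 - p.2‖ ≤ r} =
      ∫⁻ z in closedBall (0 : EuclideanSpace ℝ (Fin d)) r, volume (B ∩ closedBall z 1) := by
    calc
      _ = ∫⁻ x, ∫⁻ y, F x y := by
        rw [Measure.prod_restrict, Measure.restrict_apply hSm, ← lintegral_indicator_one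
          (hSm.inter (hBm.prod hBm)), lintegral_prod]
        · refine lintegral_congr fun x ↦ lintegral_congr fun y ↦ ?_
          simp only [F, Set.indicator_apply]
          congr 1
          simp
          tauto
        · exact (measurable_one.indicator (hSm.inter (hBm.prod hBm))).aemeasurable
      _ = ∫⁻ x, ∫⁻ z, F x (x - z) := by
        refine lintegral_congr fun x ↦ (lintegral_sub_left_eq_self (F x) x).symm
      _ = ∫⁻ z, ∫⁻ x, F x (x - z) :=
        lintegral_lintegral_swap (hFm.comp (by fun_prop :
          Measurable fun p : EuclideanSpace ℝ (Fin d) × EuclideanSpace ℝ (Fin d) ↦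
            (p.1, p.1 - p.2))).aemeasurable
      _ = _ := by
        rw [← lintegral_indicator measurableSet_closedBall]
        refine lintegral_congr fun z ↦ ?_
        by_cases hz : z ∈ closedBall (0 : EuclideanSpace ℝ (Fin d)) r
        · rw [Set.indicator_of_mem hz, ← lintegral_indicator_one
            (hBm.inter measurableSet_closedBall)]
          refine lintegral_congr fun x ↦ ?_
          have hz' : ‖z‖ ≤ r := by simpa using hz
          simp only [F, Set.indicator_apply]
          congr 1
          simp [hB, hz', dist_eq_norm]
        · rw [Set.indicator_of_notMem hz]
          have hz' : ¬ ‖z‖ ≤ r := by simpa using hz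
          simp [F, hz']
  rw [unifBall, Measure.prod_smul_left, Measure.prod_smul_right, Measure.smul_apply,
    Measure.smul_apply, key]
  simp [hB]

lemma lintegral_volume_inter_closedBall (n : ℕ) {t : ℝ} (ht0 : 0 ≤ t) (ht1 : t ≤ 1) :
    ∫⁻ z in closedBall (0 : EuclideanSpace ℝ (Fin (n + 1))) (2 * t),
        volume (closedBall (0 : EuclideanSpace ℝ (Fin (n + 1))) 1 ∩ closedBall z 1) =
      ENNReal.ofReal (unitBallVolume (n + 1) ^ 2 * ∫ w in (0 : ℝ)..t,
        2 ^ (n + 1) * ((n + 1 : ℕ) : ℝ) * w ^ n *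
          regIncBeta (1 - w ^ 2) (((n : ℝ) + 2) / 2) (1 / 2)) := by
  let g : ℝ → ℝ := fun r ↦ unitBallVolume n * (2 * ∫ s in (r / 2)..1, √(1 - s ^ 2) ^ n)
  have hg : Continuous g := by
    have : Continuous fun x : ℝ ↦ ∫ s in x..1, √(1 - s ^ 2) ^ n := by
      simp_rw [fun x : ℝ ↦ intervalIntegral.integral_symm (μ := volume)
        (f := fun s : ℝ ↦ √(1 - s ^ 2) ^ n) 1 x]
      exact (intervalIntegral.continuous_primitive
        (fun a b ↦ (by fun_prop : Continuous fun s : ℝ ↦ √(1 - s ^ 2) ^ n).intervalIntegrable a b)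
        1).neg
    exact continuous_const.mul (continuous_const.mul (this.comp (by fun_prop)))
  have hg0 : ∀ r ≤ 2, 0 ≤ g r := fun r hr ↦
    mul_nonneg (unitBallVolume_pos n).le (mul_nonneg zero_le_two
      (intervalIntegral.integral_nonneg (by linarith) fun s _ ↦ by positivity))
  rw [setLIntegral_congr_fun (g := fun z ↦ ENNReal.ofReal (g ‖z‖)) measurableSet_closedBall
      fun z hz ↦ volume_inter_closedBall n z (by
        have : ‖z‖ ≤ 2 * t := by simpa using hz
        linarith),
    ← ofReal_integral_eq_lintegral_ofReal (f := fun z ↦ g ‖z‖)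
      ((hg.comp continuous_norm).continuousOn.integrableOn_compact (isCompact_closedBall _ _))
      ((ae_restrict_iff' measurableSet_closedBall).mpr (ae_of_all _ fun z hz ↦ hg0 _ (by
        have : ‖z‖ ≤ 2 * t := by simpa using hz
        linarith)))]
  congr 1
  have hind : (closedBall (0 : EuclideanSpace ℝ (Fin (n + 1))) (2 * t)).indicator
      (fun z ↦ g ‖z‖) = fun z ↦ (Set.Iic (2 * t)).indicator g ‖z‖ := by
    classical
    ext z
    simp [Set.indicator_apply]
  have hball : volume.real (ball (0 : EuclideanSpace ℝ (Fin (n + 1))) 1) =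
      unitBallVolume (n + 1) := by
    rw [measureReal_def, ← Measure.addHaar_closedBall_eq_addHaar_ball,
      volume_closedBall_eq_unitBallVolume _ zero_le_one, one_pow, one_mul,
      ENNReal.toReal_ofReal (unitBallVolume_pos _).le]
  have hradial : ∫ y in Set.Ioi (0 : ℝ), y ^ n • (Set.Iic (2 * t)).indicator g y =
      ∫ y in (0 : ℝ)..(2 * t), y ^ n * g y := by
    rw [intervalIntegral.integral_of_le (by positivity), ← Set.Ioi_inter_Iic,
      ← setIntegral_indicator measurableSet_Iic]
    refine setIntegral_congr_fun measurableSet_Ioi fun y _ ↦ ?_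
    by_cases hy : y ∈ Set.Iic (2 * t) <;> simp [hy]
  have hscale := intervalIntegral.mul_integral_comp_mul_left (a := 0) (b := t)
    (f := fun y ↦ y ^ n * g y) 2
  rw [← integral_indicator measurableSet_closedBall, hind, integral_fun_norm_addHaar, hball,
    finrank_euclideanSpace_fin, Nat.add_sub_cancel, hradial, nsmul_eq_mul, smul_eq_mul,
    ← mul_zero (2 : ℝ), ← hscale, mul_zero, ← intervalIntegral.integral_const_mul,
    ← intervalIntegral.integral_const_mul, ← intervalIntegral.integral_const_mul,
    ← intervalIntegral.integral_const_mul, intervalIntegral.integral_of_le ht0,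
    intervalIntegral.integral_of_le ht0]
  refine setIntegral_congr_fun measurableSet_Ioc fun w hw ↦ ?_
  have h := unitBallVolume_mul_regIncBeta n hw.1 (hw.2.trans ht1)
  have hgw : g (2 * w) =
      unitBallVolume (n + 1) * regIncBeta (1 - w ^ 2) (((n : ℝ) + 2) / 2) (1 / 2) := by
    rw [h]
    simp only [g, mul_div_cancel_left₀ w (two_ne_zero' ℝ)]
  simp only [hgw]
  ring

theorem stmt16 {d : ℕ} (hd : 1 ≤ d)
    {Ω : Type*} [MeasurableSpace Ω] (P : Measure Ω) [IsProbabilityMeasure P]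
    (A₁ A₂ : Ω → EuclideanSpace ℝ (Fin d))
    (h1 : Measurable A₁) (h2 : Measurable A₂)
    (hindep : IndepFun A₁ A₂ P)
    (hl1 : Measure.map A₁ P = unifBall d) (hl2 : Measure.map A₂ P = unifBall d) :
    ∀ t ∈ Set.Icc (0 : ℝ) 1,
      P {ω | ‖A₁ ω - A₂ ω‖ / 2 ≤ t} =
        ENNReal.ofReal (∫ w in (0 : ℝ)..t,
          (2 : ℝ) ^ d * d * w ^ (d - 1) * regIncBeta (1 - w ^ 2) (((d : ℝ) + 1) / 2) (1 / 2)) := by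
  obtain ⟨n, rfl⟩ : ∃ n, d = n + 1 := ⟨d - 1, by omega⟩
  rintro t ⟨ht0, ht1⟩
  have hset : P {ω | ‖A₁ ω - A₂ ω‖ / 2 ≤ t} =
      P.map (fun ω ↦ (A₁ ω, A₂ ω)) {p | ‖p.1 - p.2‖ ≤ 2 * t} := by
    rw [Measure.map_apply (h1.prodMk h2) (measurableSet_le (by fun_prop) measurable_const)]
    congr 1
    ext ω
    simp [div_le_iff₀']
  have hκ := unitBallVolume_pos (n + 1)
  rw [hset, (indepFun_iff_map_prod_eq_prod_map_map h1.aemeasurable h2.aemeasurable).mp hindep,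
    hl1, hl2, unifBall_prod_setOf_norm_sub_le, lintegral_volume_inter_closedBall n ht0 ht1,
    volume_closedBall_eq_unitBallVolume _ zero_le_one, one_pow, one_mul,
    ← ENNReal.ofReal_inv_of_pos hκ, ← ENNReal.ofReal_mul (by positivity),
    ← ENNReal.ofReal_mul (by positivity)]
  congr 1
  rw [show ((n : ℝ) + 2) / 2 = (((n + 1 : ℕ) : ℝ) + 1) / 2 by push_cast; ring, Nat.add_sub_cancel]
  field_simp


end
end

section
/- Let d ≥ 1 and let X and Y be independent random points, each uniformly distributed on the unit sphere S^{d+1} = {x ∈ ℝ^{d+2} : ‖x‖ = 1}. Then the square of the half-distance, (‖X − Y‖/2)², has the beta distribution Beta((d+1)/2, (d+1)/2); equivalently, for every t ∈ [0, 1], P(‖X − Y‖/2 ≤ t) = (2/B((d+1)/2, (d+1)/2)) · ∫₀^t ω^d (1−ω²)^{(d−1)/2} dω. -/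
open MeasureTheory ProbabilityTheory Metric Real

noncomputable section

/-- Polar coordinates for the Lebesgue integral of a radial function. -/
lemma lintegral_fun_norm_eq_const_mul {n : ℕ} :
    ∃ c : ENNReal, ∀ f : ℝ → ENNReal, Measurable f →
      ∫⁻ x : EuclideanSpace ℝ (Fin (n + 1)), f ‖x‖ =
        c * ∫⁻ r in Set.Ioi (0 : ℝ), ENNReal.ofReal (r ^ n) * f r := by
  let E := EuclideanSpace ℝ (Fin (n + 1))
  refine ⟨(volume : Measure E).toSphere Set.univ, fun f hf => ?_⟩
  have hmp := (volume : Measure E).measurePreserving_homeomorphUnitSphereProd.lintegral_comp_emb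
    (Homeomorph.measurableEmbedding _) (fun p => f p.2)
  simp only [homeomorphUnitSphereProd_apply_snd_coe] at hmp
  rw [lintegral_subtype_comap (measurableSet_singleton _).compl fun x : E => f ‖x‖,
    restrict_compl_singleton] at hmp
  have hf' : Measurable fun r : Set.Ioi (0 : ℝ) => f r := hf.comp measurable_subtype_coe
  have hpow : Measurable fun r : Set.Ioi (0 : ℝ) => ENNReal.ofReal ((r : ℝ) ^ n) := by fun_prop
  have hprod := lintegral_prod_mul (μ := (volume : Measure E).toSphere)
    (ν := Measure.volumeIoiPow n) (f := fun _ => 1) aemeasurable_const hf'.aemeasurable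
  have hdim : Module.finrank ℝ E - 1 = n := by simp [E]
  simp only [one_mul, lintegral_const] at hprod
  rw [hmp, hdim, hprod, Measure.volumeIoiPow, lintegral_withDensity_eq_lintegral_mul _ hpow hf']
  simp only [Pi.mul_apply]
  rw [lintegral_subtype_comap measurableSet_Ioi fun r : ℝ => ENNReal.ofReal (r ^ n) * f r]

/-- Fubini for a function of the first coordinate and of the norm. -/
lemma lintegral_fun_coord_norm {n : ℕ} {f : ℝ × ℝ → ENNReal} (hf : Measurable f) :
    ∫⁻ x : EuclideanSpace ℝ (Fin (n + 1)), f (x 0, ‖x‖) =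
      ∫⁻ a : ℝ, ∫⁻ b : EuclideanSpace ℝ (Fin n), f (a, √(a ^ 2 + ‖b‖ ^ 2)) := by
  have h₁ := (MeasurePreserving.id (volume : Measure ℝ)).prod (PiLp.volume_preserving_ofLp (Fin n))
  have h₂ := (volume_preserving_piFinSuccAbove (fun _ : Fin (n + 1) => ℝ) 0).symm
  have h₃ := PiLp.volume_preserving_toLp (Fin (n + 1))
  have h := h₃.comp (h₂.comp h₁)
  rw [← h.map_eq, lintegral_map (by fun_prop) h.measurable, lintegral_prod]
  · refine lintegral_congr fun a => lintegral_congr fun b => ?_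
    simp [EuclideanSpace.norm_eq, Fin.sum_univ_succ, Fin.insertNthEquiv,
      Real.sq_sqrt (Finset.sum_nonneg fun i _ => sq_nonneg (b i))]
  · exact ((by fun_prop : Measurable fun x : EuclideanSpace ℝ (Fin (n + 1)) =>
      f (x 0, ‖x‖)).comp h.measurable).aemeasurable

/-- The part of the unit ball cut out by a circular cone, in polar coordinates. -/
lemma volume_ball_inter_cone (d : ℕ) :
    ∃ K : ENNReal, ∀ s : ℝ,
      volume {x : EuclideanSpace ℝ (Fin (d + 2)) | ‖x‖ < 1 ∧ s * ‖x‖ ≤ x 0} =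
        K * ∫⁻ θ in Set.Ioo 0 π, {θ | s ≤ cos θ}.indicator
          (fun θ => ENNReal.ofReal (sin θ ^ d)) θ := by
  obtain ⟨c, hc⟩ := lintegral_fun_norm_eq_const_mul (n := d)
  refine ⟨c * ∫⁻ ρ in Set.Ioi (0 : ℝ), {ρ | ρ < 1}.indicator
    (fun ρ => ENNReal.ofReal (ρ ^ (d + 1))) ρ, fun s => ?_⟩
  have hA : MeasurableSet {p : ℝ × ℝ | p.2 < 1 ∧ s * p.2 ≤ p.1} := by measurability
  set f : ℝ × ℝ → ENNReal := {p : ℝ × ℝ | p.2 < 1 ∧ s * p.2 ≤ p.1}.indicator 1 with hf_def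
  have hf : Measurable f := measurable_one.indicator hA
  have hvol : volume {x : EuclideanSpace ℝ (Fin (d + 2)) | ‖x‖ < 1 ∧ s * ‖x‖ ≤ x 0} =
      ∫⁻ x : EuclideanSpace ℝ (Fin (d + 2)), f (x 0, ‖x‖) := by
    rw [← lintegral_indicator_one (by measurability)]
    rfl
  rw [hvol, lintegral_fun_coord_norm hf]
  have hrad (a : ℝ) : ∫⁻ b : EuclideanSpace ℝ (Fin (d + 1)), f (a, √(a ^ 2 + ‖b‖ ^ 2)) =
      c * ∫⁻ r, (Set.Ioi (0 : ℝ)).indicator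
        (fun r => ENNReal.ofReal (r ^ d) * f (a, √(a ^ 2 + r ^ 2))) r := by
    rw [hc (fun r => f (a, √(a ^ 2 + r ^ 2))) (by fun_prop), lintegral_indicator measurableSet_Ioi]
  have hmeas : Measurable fun p : ℝ × ℝ => (Set.Ioi (0 : ℝ)).indicator
      (fun r => ENNReal.ofReal (r ^ d) * f (p.1, √(p.1 ^ 2 + r ^ 2))) p.2 := by
    have : (fun p : ℝ × ℝ => (Set.Ioi (0 : ℝ)).indicator
      (fun r => ENNReal.ofReal (r ^ d) * f (p.1, √(p.1 ^ 2 + r ^ 2))) p.2) =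
      (Prod.snd ⁻¹' Set.Ioi (0 : ℝ)).indicator
        (fun p : ℝ × ℝ => ENNReal.ofReal (p.2 ^ d) * f (p.1, √(p.1 ^ 2 + p.2 ^ 2))) := rfl
    rw [this]
    exact Measurable.indicator (by fun_prop) (measurable_snd measurableSet_Ioi)
  simp_rw [hrad]
  rw [lintegral_const_mul _ hmeas.lintegral_prod_right', ← lintegral_prod _ hmeas.aemeasurable,
    mul_assoc, ← Measure.volume_eq_prod, ← lintegral_comp_polarCoord_symm]
  congr 1
  have hIoo : Set.Ioo (0 : ℝ) π = Set.Ioo (-π) π ∩ Set.Ioi 0 := by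
    ext θ
    simp only [Set.mem_Ioo, Set.mem_inter_iff, Set.mem_Ioi]
    constructor
    · rintro ⟨h₁, h₂⟩
      exact ⟨⟨by linarith, h₂⟩, h₁⟩
    · rintro ⟨⟨_, h₂⟩, h₁⟩
      exact ⟨h₁, h₂⟩
  have hcone : MeasurableSet {θ : ℝ | s ≤ cos θ} := by measurability
  rw [hIoo, Set.inter_comm, ← Measure.restrict_restrict measurableSet_Ioi,
    ← lintegral_indicator (f := {θ | s ≤ cos θ}.indicator _) measurableSet_Ioi,
    ← lintegral_prod_mul, Measure.prod_restrict,
    ← Measure.volume_eq_prod]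
  · refine setLIntegral_congr_fun polarCoord.open_target.measurableSet ?_
    rintro ⟨ρ, θ⟩ ⟨hρ, hθ⟩
    simp only [Set.mem_Ioi, Set.mem_Ioo] at hρ hθ
    have hnorm : √((ρ * cos θ) ^ 2 + (ρ * sin θ) ^ 2) = ρ := by
      rw [show (ρ * cos θ) ^ 2 + (ρ * sin θ) ^ 2 = ρ ^ 2 by
        linear_combination ρ ^ 2 * sin_sq_add_cos_sq θ, Real.sqrt_sq hρ.le]
    have hcos : s * ρ ≤ ρ * cos θ ↔ s ≤ cos θ := by
      rw [mul_comm s, mul_le_mul_iff_right₀ hρ]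
    have hsin : 0 < ρ * sin θ ↔ 0 < θ := by
      rw [mul_pos_iff_of_pos_left hρ]
      refine ⟨fun h => ?_, fun h => sin_pos_of_pos_of_lt_pi h hθ.2⟩
      by_contra hle
      linarith [sin_nonpos_of_nonpos_of_neg_pi_le (not_lt.mp hle) hθ.1.le]
    simp only [polarCoord_symm_apply, hf_def, Set.indicator_apply, Set.mem_Ioi, hsin, hnorm,
      Set.mem_ofPred_eq, hcos, smul_eq_mul, Pi.one_apply]
    by_cases h₁ : 0 < θ <;> by_cases h₂ : ρ < 1 <;> by_cases h₃ : s ≤ cos θ <;>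
      simp only [h₁, h₂, h₃, if_true, if_false, and_self, and_true, and_false,
        mul_zero, zero_mul, mul_one]
    rw [← ENNReal.ofReal_mul hρ.le, ← ENNReal.ofReal_mul (by positivity)]
    ring_nf
  · exact (Measurable.indicator (by fun_prop) measurableSet_Iio).aemeasurable
  · exact (Measurable.indicator (Measurable.indicator (by fun_prop) hcone)
      measurableSet_Ioi).aemeasurable

/-- The angular integral over the cap of angle `α`. -/
lemma lintegral_indicator_sin_pow (d : ℕ) {α : ℝ} (hα : α ∈ Set.Icc 0 π) :
    ∫⁻ θ in Set.Ioo 0 π, {θ | cos α ≤ cos θ}.indicator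
      (fun θ => ENNReal.ofReal (sin θ ^ d)) θ = ENNReal.ofReal (∫ θ in 0..α, sin θ ^ d) := by
  have hset : ({θ : ℝ | cos α ≤ cos θ} ∩ Set.Ioo 0 π : Set ℝ) =ᵐ[volume] Set.Ioc 0 α := by
    refine Filter.EventuallyEq.trans ?_ Ioo_ae_eq_Ioc
    have : {θ : ℝ | cos α ≤ cos θ} ∩ Set.Ioo 0 π = Set.Ioc 0 α ∩ Set.Iio π := by
      ext θ
      simp only [Set.mem_inter_iff, Set.mem_ofPred_eq, Set.mem_Ioo, Set.mem_Ioc, Set.mem_Iio]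
      constructor
      · rintro ⟨h, h₁, h₂⟩
        exact ⟨⟨h₁, (strictAntiOn_cos.le_iff_ge hα ⟨h₁.le, h₂.le⟩).mp h⟩, h₂⟩
      · rintro ⟨⟨h₁, h⟩, h₂⟩
        exact ⟨(strictAntiOn_cos.le_iff_ge hα ⟨h₁.le, h₂.le⟩).mpr h, h₁, h₂⟩
    rw [this]
    refine (Filter.EventuallyEq.inter Ioo_ae_eq_Ioc.symm (ae_eq_refl _)).trans ?_
    rw [Set.inter_eq_left.mpr fun θ hθ => hθ.2.trans_le hα.2]
    exact ae_eq_refl _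
  have hcone : MeasurableSet {θ : ℝ | cos α ≤ cos θ} := by measurability
  rw [lintegral_indicator hcone, Measure.restrict_restrict hcone, Measure.restrict_congr_set hset,
    intervalIntegral.integral_of_le hα.1, ofReal_integral_eq_lintegral_ofReal]
  · exact (continuous_sin.pow d).integrableOn_Ioc
  · filter_upwards [ae_restrict_mem measurableSet_Ioc] with θ hθ
    exact pow_nonneg (sin_nonneg_of_nonneg_of_le_pi hθ.1.le (hθ.2.trans hα.2)) _

/-- The substitution `w = sin (θ / 2)`. -/
lemma integral_sin_pow_eq_integral_half_angle {d : ℕ} (hd : 1 ≤ d) {α : ℝ}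
    (hα : α ∈ Set.Icc 0 π) :
    ∫ θ in 0..α, sin θ ^ d =
      2 ^ (d + 1) * ∫ w in 0..sin (α / 2), w ^ d * (1 - w ^ 2) ^ (((d : ℝ) - 1) / 2) := by
  have hd' : (1 : ℝ) ≤ d := by exact_mod_cast hd
  have hcont : Continuous fun w : ℝ => w ^ d * (1 - w ^ 2) ^ (((d : ℝ) - 1) / 2) :=
    (continuous_pow d).mul
      ((by fun_prop : Continuous fun w : ℝ => 1 - w ^ 2).rpow_const fun _ => Or.inr (by linarith))
  have hder (θ : ℝ) : HasDerivAt (fun θ => sin (θ / 2)) (cos (θ / 2) * (1 / 2)) θ :=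
    ((hasDerivAt_id θ).div_const 2).sin
  have hsub := intervalIntegral.integral_comp_mul_deriv (a := 0) (b := α)
    (fun θ _ => hder θ) (by fun_prop) hcont
  simp only [zero_div, sin_zero] at hsub
  rw [← hsub, ← intervalIntegral.integral_const_mul]
  refine intervalIntegral.integral_congr fun θ hθ => ?_
  rw [Set.uIcc_of_le hα.1] at hθ
  have hcos : 0 ≤ cos (θ / 2) :=
    cos_nonneg_of_neg_pi_div_two_le_of_le (by linarith [hθ.1, pi_pos]) (by linarith [hθ.2, hα.2])
  have hpow : (1 - sin (θ / 2) ^ 2) ^ (((d : ℝ) - 1) / 2) = cos (θ / 2) ^ (d - 1) := by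
    rw [← cos_sq', ← rpow_natCast, ← rpow_natCast, ← rpow_mul hcos, Nat.cast_sub hd]
    congr 1
    push_cast
    ring
  simp only [Function.comp_apply, hpow]
  obtain ⟨k, rfl⟩ : ∃ k, d = k + 1 := ⟨d - 1, by omega⟩
  have hdouble : sin θ = 2 * sin (θ / 2) * cos (θ / 2) := by
    rw [← sin_two_mul]
    congr 1
    ring
  rw [hdouble]
  simp only [Nat.add_sub_cancel]
  ring

lemma realBeta_pos {a b : ℝ} (ha : 0 < a) (hb : 0 < b) : 0 < realBeta a b :=
  div_pos (mul_pos (Gamma_pos_of_pos ha) (Gamma_pos_of_pos hb)) (Gamma_pos_of_pos (by positivity))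

lemma realBeta_add_one_add_one {a : ℝ} (ha : 0 < a) :
    realBeta (a + 1) (a + 1) = a / (2 * (2 * a + 1)) * realBeta a a := by
  have hG : Gamma (a + a) ≠ 0 := (Gamma_pos_of_pos (by positivity)).ne'
  have h₁ : (a + 1) + (a + 1) = (a + a + 1) + 1 := by ring
  rw [realBeta, realBeta, h₁, Gamma_add_one ha.ne', Gamma_add_one (s := a + a + 1) (by positivity),
    Gamma_add_one (s := a + a) (by positivity)]
  field_simp
  ring

/-- The Wallis integrals as beta values. -/
lemma integral_sin_pow_eq_realBeta (d : ℕ) :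
    ∫ θ in 0..π, sin θ ^ d = 2 ^ d * realBeta (((d : ℝ) + 1) / 2) (((d : ℝ) + 1) / 2) := by
  induction d using Nat.twoStepInduction with
  | zero =>
    simp only [realBeta, CharP.cast_eq_zero, zero_add, add_halves, Gamma_one,
      Gamma_one_half_eq, pow_zero]
    simp [Real.mul_self_sqrt pi_pos.le]
  | one =>
    have : ((1 : ℕ) + 1 : ℝ) / 2 = 1 := by norm_num
    rw [this, realBeta, Gamma_one, one_add_one_eq_two, Gamma_two]
    norm_num
  | more n ih _ =>
    have h : (((n + 2 : ℕ) : ℝ) + 1) / 2 = ((n : ℝ) + 1) / 2 + 1 := by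
      push_cast
      ring
    rw [integral_sin_pow, ih, h, realBeta_add_one_add_one (by positivity)]
    simp only [sin_zero, sin_pi]
    field_simp
    ring

lemma exists_linearIsometryEquiv_apply_eq {E : Type*} [NormedAddCommGroup E]
    [InnerProductSpace ℝ E] {v w : E} (h : ‖v‖ = ‖w‖) : ∃ R : E ≃ₗᵢ[ℝ] E, R v = w :=
  ⟨_, Submodule.reflection_sub h⟩

/-- A rotation-invariant measure gives the same mass to all caps of a given size. -/
lemma measure_cap_eq_of_norm_eq {E : Type*} [NormedAddCommGroup E] [InnerProductSpace ℝ E]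
    [MeasurableSpace E] [BorelSpace E] {μ : Measure E}
    (hrot : ∀ R : E ≃ₗᵢ[ℝ] E, μ.map R = μ) {v w : E} (h : ‖v‖ = ‖w‖) (s : ℝ) :
    μ {x | s ≤ inner ℝ x v} = μ {x | s ≤ inner ℝ x w} := by
  obtain ⟨R, rfl⟩ := exists_linearIsometryEquiv_apply_eq h
  have hmeas : MeasurableSet {x : E | s ≤ inner ℝ x (R v)} :=
    (isClosed_le continuous_const (by fun_prop)).measurableSet
  conv_rhs => rw [← hrot R, Measure.map_apply R.continuous.measurable hmeas]
  simp

/-- A rotation-invariant probability measure on the sphere gives a cap the same mass as the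
uniform measure on the ball gives to the corresponding cone. -/
lemma measure_cap_mul_volume_ball {n : ℕ} {μ : Measure (EuclideanSpace ℝ (Fin (n + 1)))}
    [IsProbabilityMeasure μ] (hsupp : μ (sphere 0 1)ᶜ = 0)
    (hrot : ∀ R : EuclideanSpace ℝ (Fin (n + 1)) ≃ₗᵢ[ℝ] EuclideanSpace ℝ (Fin (n + 1)),
      μ.map R = μ) {y : EuclideanSpace ℝ (Fin (n + 1))} (hy : ‖y‖ = 1) (s : ℝ) :
    μ {x | s ≤ inner ℝ x y} * volume (ball (0 : EuclideanSpace ℝ (Fin (n + 1))) 1) =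
      volume {x : EuclideanSpace ℝ (Fin (n + 1)) | ‖x‖ < 1 ∧ s * ‖x‖ ≤ x 0} := by
  let E := EuclideanSpace ℝ (Fin (n + 1))
  have hA : MeasurableSet {p : E × E | s * ‖p.1‖ ≤ inner ℝ p.2 p.1} :=
    (isClosed_le (by fun_prop) (by fun_prop)).measurableSet
  have hleft : ((volume.restrict (ball (0 : E) 1)).prod μ)
      {p : E × E | s * ‖p.1‖ ≤ inner ℝ p.2 p.1} =
      μ {x | s ≤ inner ℝ x y} * volume (ball (0 : E) 1) := by
    rw [Measure.prod_apply hA, ← setLIntegral_const]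
    refine lintegral_congr_ae (ae_restrict_of_ae ?_)
    filter_upwards [compl_mem_ae_iff.mpr (measure_singleton (0 : E))] with g hg
    have hg' : 0 < ‖g‖ := norm_pos_iff.mpr hg
    have hnorm : ‖‖g‖⁻¹ • g‖ = ‖y‖ := by
      rw [norm_smul, norm_inv, norm_norm, inv_mul_cancel₀ hg'.ne', hy]
    rw [← measure_cap_eq_of_norm_eq hrot hnorm]
    congr 1
    ext x
    change s * ‖g‖ ≤ inner ℝ x g ↔ s ≤ inner ℝ x (‖g‖⁻¹ • g)
    rw [real_inner_smul_right, inv_mul_eq_div, le_div_iff₀ hg']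
  have hright : ((volume.restrict (ball (0 : E) 1)).prod μ)
      {p : E × E | s * ‖p.1‖ ≤ inner ℝ p.2 p.1} =
      volume {x : E | ‖x‖ < 1 ∧ s * ‖x‖ ≤ x 0} := by
    rw [Measure.prod_apply_symm hA]
    have hconst : (fun _ : E => volume {x : E | ‖x‖ < 1 ∧ s * ‖x‖ ≤ x 0}) =ᵐ[μ]
        fun x => (volume.restrict (ball (0 : E) 1))
          ((fun g => (g, x)) ⁻¹' {p : E × E | s * ‖p.1‖ ≤ inner ℝ p.2 p.1}) := by
      filter_upwards [mem_ae_iff.mpr hsupp] with x hx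
      rw [mem_sphere_zero_iff_norm] at hx
      obtain ⟨R, hR⟩ := exists_linearIsometryEquiv_apply_eq
        (show ‖(EuclideanSpace.single 0 1 : E)‖ = ‖x‖ by simp [hx])
      have hB : MeasurableSet ((fun g => (g, x)) ⁻¹' {p : E × E | s * ‖p.1‖ ≤ inner ℝ p.2 p.1}) :=
        hA.preimage (by fun_prop)
      rw [Measure.restrict_apply hB, ← R.measurePreserving.measure_preimage
        (hB.inter measurableSet_ball).nullMeasurableSet]
      congr 1
      ext g
      change ‖g‖ < 1 ∧ s * ‖g‖ ≤ g 0 ↔ s * ‖R g‖ ≤ inner ℝ x (R g) ∧ R g ∈ ball 0 1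
      rw [← hR, R.inner_map_map, EuclideanSpace.inner_single_left, mem_ball_zero_iff, R.norm_map,
        map_one, one_mul, and_comm]
    rw [← lintegral_congr_ae hconst]
    simp
  rw [← hleft, hright]

/-- The mass of a cap under the rotation-invariant probability measure on the sphere. -/
lemma measure_cap_eq_ofReal {d : ℕ} {μ : Measure (EuclideanSpace ℝ (Fin (d + 2)))}
    [IsProbabilityMeasure μ] (hsupp : μ (sphere 0 1)ᶜ = 0)
    (hrot : ∀ R : EuclideanSpace ℝ (Fin (d + 2)) ≃ₗᵢ[ℝ] EuclideanSpace ℝ (Fin (d + 2)),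
      μ.map R = μ) {y : EuclideanSpace ℝ (Fin (d + 2))} (hy : ‖y‖ = 1) {α : ℝ}
    (hα : α ∈ Set.Icc 0 π) :
    μ {x | cos α ≤ inner ℝ x y} =
      ENNReal.ofReal ((∫ θ in 0..α, sin θ ^ d) / ∫ θ in 0..π, sin θ ^ d) := by
  obtain ⟨K, hK⟩ := volume_ball_inter_cone d
  set V := volume (ball (0 : EuclideanSpace ℝ (Fin (d + 2))) 1) with hV_def
  have hV : V ≠ 0 := (measure_ball_pos volume _ one_pos).ne'
  have hV' : V ≠ ⊤ := measure_ball_lt_top.ne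
  have hcap {β : ℝ} (hβ : β ∈ Set.Icc 0 π) :
      μ {x | cos β ≤ inner ℝ x y} * V = K * ENNReal.ofReal (∫ θ in 0..β, sin θ ^ d) := by
    rw [hV_def, measure_cap_mul_volume_ball hsupp hrot hy, hK, lintegral_indicator_sin_pow d hβ]
  have hfull : V = K * ENNReal.ofReal (∫ θ in 0..π, sin θ ^ d) := by
    have hone : μ {x | cos π ≤ inner ℝ x y} = 1 := by
      rw [← mem_ae_iff_prob_eq_one (isClosed_le continuous_const (by fun_prop)).measurableSet]
      filter_upwards [mem_ae_iff.mpr hsupp] with x hx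
      rw [mem_sphere_zero_iff_norm] at hx
      simpa [hx, hy] using neg_le_of_abs_le (abs_real_inner_le_norm x y)
    rw [← hcap ⟨pi_pos.le, le_rfl⟩, hone, one_mul]
  have hI : 0 < ∫ θ in 0..π, sin θ ^ d := integral_sin_pow_pos d
  refine (ENNReal.mul_left_inj hV hV').mp ?_
  rw [hcap hα, ENNReal.ofReal_div_of_pos hI]
  conv_rhs => rw [hfull]
  rw [mul_left_comm, ENNReal.div_mul_cancel]
  · simpa using hI
  · exact ENNReal.ofReal_ne_top

theorem stmt17 {d : ℕ} (hd : 1 ≤ d)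
    (μS : Measure (EuclideanSpace ℝ (Fin (d + 2)))) [IsProbabilityMeasure μS]
    (hsupp : μS (Metric.sphere (0 : EuclideanSpace ℝ (Fin (d + 2))) 1)ᶜ = 0)
    (hrot : ∀ R : EuclideanSpace ℝ (Fin (d + 2)) ≃ₗᵢ[ℝ] EuclideanSpace ℝ (Fin (d + 2)),
      Measure.map R μS = μS)
    {Ω : Type*} [MeasurableSpace Ω] (P : Measure Ω) [IsProbabilityMeasure P]
    (X Y : Ω → EuclideanSpace ℝ (Fin (d + 2)))
    (hX : Measurable X) (hY : Measurable Y)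
    (hindep : IndepFun X Y P)
    (hlX : Measure.map X P = μS) (hlY : Measure.map Y P = μS) :
    ∀ t ∈ Set.Icc (0 : ℝ) 1,
      P {ω | ‖X ω - Y ω‖ / 2 ≤ t} =
        ENNReal.ofReal ((2 / realBeta (((d : ℝ) + 1) / 2) (((d : ℝ) + 1) / 2)) *
          ∫ w in (0 : ℝ)..t, w ^ d * (1 - w ^ 2) ^ (((d : ℝ) - 1) / 2)) := by
  intro t ht
  have hα : 2 * arcsin t ∈ Set.Icc 0 π :=
    ⟨mul_nonneg zero_le_two (arcsin_nonneg.mpr ht.1), by linarith [arcsin_le_pi_div_two t]⟩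
  have hsin : sin (2 * arcsin t / 2) = t := by
    rw [mul_div_cancel_left₀ _ two_ne_zero, sin_arcsin (by linarith [ht.1]) ht.2]
  have hcos : cos (2 * arcsin t) = 1 - 2 * t ^ 2 := by
    rw [cos_two_mul, cos_sq', sin_arcsin (by linarith [ht.1]) ht.2]
    ring
  have hA : MeasurableSet {p : EuclideanSpace ℝ (Fin (d + 2)) × EuclideanSpace ℝ (Fin (d + 2)) |
      ‖p.1 - p.2‖ / 2 ≤ t} := (isClosed_le (by fun_prop) continuous_const).measurableSet
  have hprod : P {ω | ‖X ω - Y ω‖ / 2 ≤ t} = (μS.prod μS) {p | ‖p.1 - p.2‖ / 2 ≤ t} := by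
    have h := (indepFun_iff_map_prod_eq_prod_map_map hX.aemeasurable hY.aemeasurable).mp hindep
    rw [hlX, hlY] at h
    rw [← h, Measure.map_apply (hX.prodMk hY) hA]
    rfl
  have hsection : (fun y => μS ((fun x => (x, y)) ⁻¹' {p | ‖p.1 - p.2‖ / 2 ≤ t})) =ᵐ[μS]
      fun _ => ENNReal.ofReal ((∫ θ in 0..2 * arcsin t, sin θ ^ d) / ∫ θ in 0..π, sin θ ^ d) := by
    filter_upwards [mem_ae_iff.mpr hsupp] with y hy
    rw [mem_sphere_zero_iff_norm] at hy
    rw [← measure_cap_eq_ofReal hsupp hrot hy hα]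
    refine measure_congr ?_
    filter_upwards [mem_ae_iff.mpr hsupp] with x hx
    rw [mem_sphere_zero_iff_norm] at hx
    refine propext ?_
    change ‖x - y‖ / 2 ≤ t ↔ cos (2 * arcsin t) ≤ inner ℝ x y
    have hsq : ‖x - y‖ ^ 2 = 2 - 2 * inner ℝ x y := by
      rw [norm_sub_sq_real, hx, hy]
      ring
    rw [div_le_iff₀ two_pos, ← sq_le_sq₀ (norm_nonneg _) (by linarith [ht.1]), hsq, hcos]
    constructor <;> intro h <;> linarith
  rw [hprod, Measure.prod_apply_symm hA, lintegral_congr_ae hsection, lintegral_const,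
    measure_univ, mul_one, integral_sin_pow_eq_integral_half_angle hd hα, hsin,
    integral_sin_pow_eq_realBeta]
  have hB : realBeta (((d : ℝ) + 1) / 2) (((d : ℝ) + 1) / 2) ≠ 0 :=
    (realBeta_pos (by positivity) (by positivity)).ne'
  congr 1
  field_simp
  ring

end
end
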